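/- arXiv:1704.04286 — 6 statements merged into one kernel-verified Lean document; each statement's English description precedes it below -/
import Mathlib

section
/- Suppose given a commutative 3×3 diagram of R-modules with exact rows 0 → P → E → R → 0, 0 → H → X → F → 0, 0 → S → G → Q → 0 and exact columns 0 → P → H → S → 0, 0 → E → X → G → 0, 0 → R → F → Q → 0. Let Y be the pullback of F → Q and G → Q. Then there exists a map X → Y, induced by the pullback property from X → F and X → G := (X → F → Q lifted via X → G), such that the sequence 0 → P → X → Y → 0 is exact, where P → X is the composite P → E → X. -/
/-- The pullback `F ×_Q G`, realized as a submodule of `F × G`. -/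
def modulePullback {A : Type*} [CommRing A] {F G Q : Type*}
    [AddCommGroup F] [AddCommGroup G] [AddCommGroup Q]
    [Module A F] [Module A G] [Module A Q]
    (pF : F →ₗ[A] Q) (pG : G →ₗ[A] Q) : Submodule A (F × G) :=
  LinearMap.ker (pF.comp (LinearMap.fst A F G) - pG.comp (LinearMap.snd A F G))

/-- Given a commutative 3×3 diagram with short exact rows
`0 → P → E → R → 0`, `0 → H → X → F → 0`, `0 → S → G → Q → 0`
and short exact columns `0 → P → H → S → 0`, `0 → E → X → G → 0`,
`0 → R → F → Q → 0`, and `Y = F ×_Q G` the pullback, the induced map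
`X → Y` (from `X → F` and `X → G`) makes `0 → P → X → Y → 0` exact,
where `P → X` is the composite `P → E → X`. -/
theorem statement3 {A : Type*} [CommRing A] {P E R H X F S G Q : Type*}
    [AddCommGroup P] [AddCommGroup E] [AddCommGroup R] [AddCommGroup H] [AddCommGroup X]
    [AddCommGroup F] [AddCommGroup S] [AddCommGroup G] [AddCommGroup Q]
    [Module A P] [Module A E] [Module A R] [Module A H] [Module A X]
    [Module A F] [Module A S] [Module A G] [Module A Q]
    -- rows
    (pe : P →ₗ[A] E) (er : E →ₗ[A] R)
    (hx : H →ₗ[A] X) (xf : X →ₗ[A] F)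
    (sg : S →ₗ[A] G) (gq : G →ₗ[A] Q)
    -- columns
    (ph : P →ₗ[A] H) (hs : H →ₗ[A] S)
    (ex : E →ₗ[A] X) (xg : X →ₗ[A] G)
    (rf : R →ₗ[A] F) (fq : F →ₗ[A] Q)
    -- exactness of rows
    (h1 : Function.Injective pe) (h2 : Function.Exact pe er) (h3 : Function.Surjective er)
    (h4 : Function.Injective hx) (h5 : Function.Exact hx xf) (h6 : Function.Surjective xf)
    (h7 : Function.Injective sg) (h8 : Function.Exact sg gq) (h9 : Function.Surjective gq)
    -- exactness of columns
    (c1 : Function.Injective ph) (c2 : Function.Exact ph hs) (c3 : Function.Surjective hs)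
    (c4 : Function.Injective ex) (c5 : Function.Exact ex xg) (c6 : Function.Surjective xg)
    (c7 : Function.Injective rf) (c8 : Function.Exact rf fq) (c9 : Function.Surjective fq)
    -- commutativity of the four squares
    (sq1 : ∀ p : P, ex (pe p) = hx (ph p))
    (sq2 : ∀ a : E, xf (ex a) = rf (er a))
    (sq3 : ∀ b : H, xg (hx b) = sg (hs b))
    (sq4 : ∀ x : X, fq (xf x) = gq (xg x)) :
    ∃ ξ : X →ₗ[A] modulePullback fq gq,
      (∀ x : X, (ξ x : F × G) = (xf x, xg x)) ∧
      Function.Injective (ex.comp pe) ∧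
      Function.Exact (ex.comp pe) ξ ∧
      Function.Surjective ξ := by
  have mem (x : X) : xf.prod xg x ∈ modulePullback fq gq := by
    simp [modulePullback, sq4 x]
  refine ⟨(xf.prod xg).codRestrict (modulePullback fq gq) mem, fun _ => rfl, c4.comp h1, ?_, ?_⟩
  · intro x
    constructor
    · intro hξ
      have h0 : (xf x, xg x) = (0 : F × G) := congrArg Subtype.val hξ
      obtain ⟨hf, hg⟩ := Prod.mk.inj h0
      obtain ⟨a, rfl⟩ := (c5 x).1 hg
      rw [sq2] at hf
      obtain ⟨p, rfl⟩ := (h2 a).1 (c7 (hf.trans (map_zero rf).symm))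
      exact ⟨p, rfl⟩
    · rintro ⟨p, rfl⟩
      refine Subtype.ext (Prod.ext ?_ (c5.apply_apply_eq_zero (pe p)))
      change xf (ex (pe p)) = 0
      rw [sq2, h2.apply_apply_eq_zero, map_zero]
  · rintro ⟨⟨f, g⟩, hfg⟩
    replace hfg : fq f = gq g := by
      simpa [modulePullback, sub_eq_zero] using hfg
    obtain ⟨x, rfl⟩ := h6 f
    obtain ⟨s, hs'⟩ := (h8 (g - xg x)).1 (by rw [map_sub, ← hfg, sq4, sub_self])
    obtain ⟨b, rfl⟩ := c3 s
    refine ⟨x + hx b, Subtype.ext (Prod.ext ?_ ?_)⟩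
    · change xf (x + hx b) = xf x
      rw [map_add, h5.apply_apply_eq_zero, add_zero]
    · change xg (x + hx b) = g
      rw [map_add, sq3, hs', add_sub_cancel]
end

section
/- Suppose given a commutative diagram in which 0 → P → E → R → 0, 0 → R → F → Q → 0, 0 → P → H → S → 0, 0 → S → G → Q → 0 are exact, and suppose X is a module together with injections E → X and H → X, surjections X → F and X → G, such that P → E → X = P → H → X, E → X → F = E → R → F, H → X → G = H → S → G, X → F → Q = X → G → Q, with 0 → E → X → G → 0 and 0 → H → X → F → 0 exact. Then, with W the pushout of 0 → P ⊕ P → E ⊕ H → R ⊕ S → 0 along the codiagonal ∇ and Y the pullback of F → Q and G → Q, there exist maps W → X and X → Y making 0 → P → W → X exact at W (W → X injective on the image) and forming exact sequences 0 → P → X → Y → 0 and 0 → W → X → Q → 0. -/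
/-- The map `P ⊕ P → P ⊕ (E ⊕ H)`, `(p₁, p₂) ↦ (p₁ + p₂, (-e p₁, -h p₂))`. -/
def codiagonalRelation {A : Type*} [CommRing A] {P E H : Type*}
    [AddCommGroup P] [AddCommGroup E] [AddCommGroup H]
    [Module A P] [Module A E] [Module A H]
    (e : P →ₗ[A] E) (h : P →ₗ[A] H) : (P × P) →ₗ[A] (P × (E × H)) :=
  (LinearMap.fst A P P + LinearMap.snd A P P).prod
    (-((e.comp (LinearMap.fst A P P)).prod (h.comp (LinearMap.snd A P P))))

/-- The codiagonal pushout `W = (P ⊕ (E ⊕ H)) / {(∇ p, -i p)}`. -/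
def codiagonalPushout {A : Type*} [CommRing A] {P E H : Type*}
    [AddCommGroup P] [AddCommGroup E] [AddCommGroup H]
    [Module A P] [Module A E] [Module A H]
    (e : P →ₗ[A] E) (h : P →ₗ[A] H) : Type _ :=
  (P × (E × H)) ⧸ LinearMap.range (codiagonalRelation e h)

noncomputable instance {A : Type*} [CommRing A] {P E H : Type*}
    [AddCommGroup P] [AddCommGroup E] [AddCommGroup H]
    [Module A P] [Module A E] [Module A H]
    (e : P →ₗ[A] E) (h : P →ₗ[A] H) : AddCommGroup (codiagonalPushout e h) :=
  inferInstanceAs (AddCommGroup ((P × (E × H)) ⧸ LinearMap.range (codiagonalRelation e h)))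

instance {A : Type*} [CommRing A] {P E H : Type*}
    [AddCommGroup P] [AddCommGroup E] [AddCommGroup H]
    [Module A P] [Module A E] [Module A H]
    (e : P →ₗ[A] E) (h : P →ₗ[A] H) : Module A (codiagonalPushout e h) :=
  inferInstanceAs (Module A ((P × (E × H)) ⧸ LinearMap.range (codiagonalRelation e h)))

/-- The map `W → X` induced by `(p, a, b) ↦ ex (e p) + ex a + hx b`. -/
noncomputable def codiagonalPushout.desc {A : Type*} [CommRing A] {P E H X : Type*}
    [AddCommGroup P] [AddCommGroup E] [AddCommGroup H] [AddCommGroup X]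
    [Module A P] [Module A E] [Module A H] [Module A X]
    (e : P →ₗ[A] E) (h : P →ₗ[A] H) (ex : E →ₗ[A] X) (hx : H →ₗ[A] X)
    (comm : ∀ p : P, ex (e p) = hx (h p)) : codiagonalPushout e h →ₗ[A] X :=
  (LinearMap.range (codiagonalRelation e h)).liftQ
    ((ex.comp e).coprod (ex.coprod hx)) (by
      rintro _ ⟨⟨p₁, p₂⟩, rfl⟩
      simp only [codiagonalRelation, LinearMap.mem_ker, LinearMap.prod_apply, Function.prod,
        LinearMap.add_apply, LinearMap.neg_apply, LinearMap.comp_apply, LinearMap.fst_apply,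
        LinearMap.snd_apply, LinearMap.coprod_apply, map_add, map_neg,
        comm]
      abel)

/-- Given the four outer short exact sequences and a completion `X` of the 3×3
diagram, there are maps `W → X` and `X → Y` (with `W` the codiagonal pushout
and `Y = F ×_Q G` the pullback) such that `W → X` is injective and compatible
with the maps from `P`, and `0 → P → X → Y → 0` and `0 → W → X → Q → 0`
are short exact. -/
theorem statement4 {A : Type*} [CommRing A] {P E R H X F S G Q : Type*}
    [AddCommGroup P] [AddCommGroup E] [AddCommGroup R] [AddCommGroup H] [AddCommGroup X]
    [AddCommGroup F] [AddCommGroup S] [AddCommGroup G] [AddCommGroup Q]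
    [Module A P] [Module A E] [Module A R] [Module A H] [Module A X]
    [Module A F] [Module A S] [Module A G] [Module A Q]
    (pe : P →ₗ[A] E) (er : E →ₗ[A] R)
    (rf : R →ₗ[A] F) (fq : F →ₗ[A] Q)
    (ph : P →ₗ[A] H) (hs : H →ₗ[A] S)
    (sg : S →ₗ[A] G) (gq : G →ₗ[A] Q)
    (h1 : Function.Injective pe) (h2 : Function.Exact pe er) (h3 : Function.Surjective er)
    (h4 : Function.Injective rf) (h5 : Function.Exact rf fq) (h6 : Function.Surjective fq)
    (h7 : Function.Injective ph) (h8 : Function.Exact ph hs) (h9 : Function.Surjective hs)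
    (h10 : Function.Injective sg) (h11 : Function.Exact sg gq) (h12 : Function.Surjective gq)
    (ex : E →ₗ[A] X) (hx : H →ₗ[A] X) (xf : X →ₗ[A] F) (xg : X →ₗ[A] G)
    (hex : Function.Injective ex) (hhx : Function.Injective hx)
    (hxf : Function.Surjective xf) (hxg : Function.Surjective xg)
    (sq1 : ∀ p : P, ex (pe p) = hx (ph p))
    (sq2 : ∀ a : E, xf (ex a) = rf (er a))
    (sq3 : ∀ b : H, xg (hx b) = sg (hs b))
    (sq4 : ∀ x : X, fq (xf x) = gq (xg x))
    (colX : Function.Exact ex xg) (rowX : Function.Exact hx xf) :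
    ∃ (w : codiagonalPushout pe ph →ₗ[A] X)
      (ξ : X →ₗ[A] modulePullback fq gq),
      (∀ z : P × (E × H),
        w (Submodule.Quotient.mk z) = ex (pe z.1) + ex z.2.1 + hx z.2.2) ∧
      (∀ x : X, (ξ x : F × G) = (xf x, xg x)) ∧
      -- `0 → P → W → X` : compatibility over `P`, and `W → X` injective
      (∀ p : P, w (Submodule.Quotient.mk (p, (0, 0))) = ex (pe p)) ∧
      Function.Injective w ∧
      -- `0 → P → X → Y → 0` is short exact
      Function.Injective (ex.comp pe) ∧ Function.Exact (ex.comp pe) ξ ∧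
      Function.Surjective ξ ∧
      -- `0 → W → X → Q → 0` is short exact
      Function.Exact w (fq.comp xf) ∧ Function.Surjective (fq.comp xf) := by
  have mem (x : X) : (xf x, xg x) ∈ modulePullback fq gq := by
    simp [modulePullback, sq4]
  have w_mk (z : P × (E × H)) : codiagonalPushout.desc pe ph ex hx sq1
      (Submodule.Quotient.mk z) = ex (pe z.1) + ex z.2.1 + hx z.2.2 := by
    change ex (pe z.1) + (ex z.2.1 + hx z.2.2) = _
    rw [add_assoc]
  refine ⟨codiagonalPushout.desc pe ph ex hx sq1,
    (xf.prod xg).codRestrict (modulePullback fq gq) mem, w_mk, fun _ => rfl,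
    fun p => ?_, ?_, hex.comp h1, fun x => ⟨fun hξ => ?_, ?_⟩, ?_,
    fun x => ⟨fun hq => ?_, ?_⟩, h6.comp hxf⟩
  · simp [w_mk]
  · rw [injective_iff_map_eq_zero]
    intro y hy
    obtain ⟨⟨p, a, b⟩, rfl⟩ := Submodule.Quotient.mk_surjective _ y
    have hab : ex (pe p) + ex a + hx b = 0 := (w_mk (p, a, b)).symm.trans hy
    have her : er (pe p + a) = 0 := by
      apply h4
      rw [← sq2, map_add, eq_neg_of_add_eq_zero_left hab, map_neg,
        rowX.apply_apply_eq_zero, neg_zero, map_zero]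
    obtain ⟨p', hp'⟩ := (h2 _).mp her
    have hb : b = -ph p' := by
      apply hhx
      rw [map_neg, ← sq1, hp', map_add]
      exact eq_neg_of_add_eq_zero_right hab
    refine (Submodule.Quotient.mk_eq_zero _).mpr ⟨(p - p', p'), ?_⟩
    simp [codiagonalRelation, hb, hp']
  · have hf : xf x = 0 := congrArg (fun y => y.1.1) hξ
    have hg : xg x = 0 := congrArg (fun y => y.1.2) hξ
    obtain ⟨a, rfl⟩ := (colX x).mp hg
    rw [sq2] at hf
    obtain ⟨p, rfl⟩ := (h2 a).mp (h4 (hf.trans (map_zero rf).symm))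
    exact ⟨p, rfl⟩
  · rintro ⟨p, rfl⟩
    apply Subtype.ext
    change (xf (ex (pe p)), xg (ex (pe p))) = 0
    simp [sq2, h2.apply_apply_eq_zero, colX.apply_apply_eq_zero]
  · rintro ⟨⟨f, g⟩, hfg⟩
    obtain ⟨x, rfl⟩ := hxf f
    have hfg' : fq (xf x) = gq g := by
      simpa [modulePullback, sub_eq_zero] using hfg
    obtain ⟨s, hs'⟩ := (h11 (g - xg x)).mp (by rw [map_sub, ← sq4, hfg', sub_self])
    obtain ⟨b, rfl⟩ := h9 s
    refine ⟨x + hx b, Subtype.ext ?_⟩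
    change (xf (x + hx b), xg (x + hx b)) = (xf x, g)
    simp [rowX.apply_apply_eq_zero, sq3, hs']
  · obtain ⟨r, hr⟩ := (h5 (xf x)).mp hq
    obtain ⟨a, rfl⟩ := h3 r
    obtain ⟨b, hb⟩ := (rowX (x - ex a)).mp (by rw [map_sub, sq2, hr, sub_self])
    exact ⟨Submodule.Quotient.mk (0, a, b), by simp [w_mk, hb]⟩
  · rintro ⟨y, rfl⟩
    obtain ⟨z, rfl⟩ := Submodule.Quotient.mk_surjective _ y
    rw [w_mk]
    simp [sq2, rowX.apply_apply_eq_zero, h5.apply_apply_eq_zero]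
end

section
/- Let 0 → E → X → G → 0 arise as follows: given exact sequences 0 → P → E → R → 0, 0 → P → H → S → 0, 0 → R → F → Q → 0, 0 → S → G → Q → 0, with Y = F ×_Q G, suppose there is an exact sequence 0 → P → X → Y → 0 compatible with P → E → X' mappings (i.e., X is an extension of Y by P whose pullback along R → Y is E and along S → Y is H). Then the induced sequence 0 → E → X → G → 0 is exact, where E → X is the induced map on pullbacks and X → G is the composite X → Y → G. -/
theorem mem_modulePullback {A : Type*} [CommRing A] {F G Q : Type*}
    [AddCommGroup F] [AddCommGroup G] [AddCommGroup Q]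
    [Module A F] [Module A G] [Module A Q]
    {pF : F →ₗ[A] Q} {pG : G →ₗ[A] Q} {y : F × G} :
    y ∈ modulePullback pF pG ↔ pF y.1 = pG y.2 := by
  simp [modulePullback, sub_eq_zero]

/-- Suppose `X` is an extension `0 → P → X → Y → 0` of `Y = F ×_Q G` by `P`
whose pullback along `R → Y` is `E` and along `S → Y` is `H` (for the given
extensions `0 → P → E → R → 0`, `0 → P → H → S → 0`, `0 → R → F → Q → 0`,
`0 → S → G → Q → 0`).  Then the induced sequence `0 → E → X → G → 0` is
exact, where `X → G` is the composite `X → Y → G`. -/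
theorem statement5 {A : Type*} [CommRing A] {P E R H X F S G Q : Type*}
    [AddCommGroup P] [AddCommGroup E] [AddCommGroup R] [AddCommGroup H] [AddCommGroup X]
    [AddCommGroup F] [AddCommGroup S] [AddCommGroup G] [AddCommGroup Q]
    [Module A P] [Module A E] [Module A R] [Module A H] [Module A X]
    [Module A F] [Module A S] [Module A G] [Module A Q]
    (pe : P →ₗ[A] E) (er : E →ₗ[A] R)
    (ph : P →ₗ[A] H) (hs : H →ₗ[A] S)
    (rf : R →ₗ[A] F) (fq : F →ₗ[A] Q)
    (sg : S →ₗ[A] G) (gq : G →ₗ[A] Q)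
    (h1 : Function.Injective pe) (h2 : Function.Exact pe er) (h3 : Function.Surjective er)
    (h4 : Function.Injective ph) (h5 : Function.Exact ph hs) (h6 : Function.Surjective hs)
    (h7 : Function.Injective rf) (h8 : Function.Exact rf fq) (h9 : Function.Surjective fq)
    (h10 : Function.Injective sg) (h11 : Function.Exact sg gq) (h12 : Function.Surjective gq)
    -- the extension `0 → P → X → Y → 0`
    (px : P →ₗ[A] X) (ξ : X →ₗ[A] modulePullback fq gq)
    (hpx : Function.Injective px) (hexX : Function.Exact px ξ)
    (hξ : Function.Surjective ξ)
    -- its pullback along `R → Y`, `r ↦ (rf r, 0)`, is `E`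
    (exE : E →ₗ[A] X)
    (hcompE : ∀ a : E, (ξ (exE a) : F × G) = (rf (er a), 0))
    (htriE : ∀ p : P, exE (pe p) = px p)
    (hpbE : ∀ (x : X) (r : R), (ξ x : F × G) = (rf r, 0) →
      ∃! a : E, exE a = x ∧ er a = r)
    -- its pullback along `S → Y`, `s ↦ (0, sg s)`, is `H`
    (hxH : H →ₗ[A] X)
    (hcompH : ∀ b : H, (ξ (hxH b) : F × G) = (0, sg (hs b)))
    (htriH : ∀ p : P, hxH (ph p) = px p)
    (hpbH : ∀ (x : X) (s : S), (ξ x : F × G) = (0, sg s) →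
      ∃! b : H, hxH b = x ∧ hs b = s) :
    -- conclusion : `0 → E → X → G → 0` is exact, `X → G = X → Y → G`
    Function.Injective exE ∧
    Function.Exact exE
      (((LinearMap.snd A F G).comp (modulePullback fq gq).subtype).comp ξ) ∧
    Function.Surjective
      (((LinearMap.snd A F G).comp (modulePullback fq gq).subtype).comp ξ) := by
  refine ⟨?_, ?_, ?_⟩
  · rw [injective_iff_map_eq_zero]
    intro a ha
    have hr : er a = 0 := by
      have h := congrArg Prod.fst (hcompE a)
      rw [ha, map_zero] at h
      exact h7 (by simpa using h.symm)
    exact (hpbE 0 0 (by simp [Prod.zero_eq_mk])).unique ⟨ha, hr⟩ ⟨map_zero _, map_zero _⟩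
  · intro x
    constructor
    · intro hx
      have hx' : (ξ x : F × G).2 = 0 := hx
      have hf : fq (ξ x : F × G).1 = 0 := by
        rw [mem_modulePullback.1 (ξ x).2, hx', map_zero]
      obtain ⟨r, hr⟩ := (h8 _).1 hf
      obtain ⟨a, ⟨ha, -⟩, -⟩ := hpbE x r (Prod.ext hr.symm hx')
      exact ⟨a, ha⟩
    · rintro ⟨a, rfl⟩
      exact congrArg Prod.snd (hcompE a)
  · intro g
    obtain ⟨f, hf⟩ := h9 (gq g)
    obtain ⟨x, hx⟩ := hξ ⟨(f, g), mem_modulePullback.2 hf⟩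
    exact ⟨x, by simp [hx]⟩
end

section
/- Given a 3×3 'frame' of short exact sequences — rows 0 → P → E → R → 0 and 0 → S → G → Q → 0, columns 0 → P → H → S → 0 and 0 → R → F → Q → 0 — there exists an object X and morphisms making a full 3×3 commutative diagram with exact rows 0 → P → E → R → 0, 0 → H → X → F → 0, 0 → S → G → Q → 0 and exact columns 0 → P → H → S → 0, 0 → E → X → G → 0, 0 → R → F → Q → 0, if and only if the Baer sum of the Yoneda products [E]∪[F] and [H]∪[G] is zero in Ext²(Q, P). -/
open CategoryTheory Abelian
universe w v u

section
open Limits Pretriangulated DerivedCategory Triangulated ShortComplex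

variable {C : Type u} [Category.{v} C] [Abelian C]

lemma singleFunctor_hom_shift_eq_zero [HasDerivedCategory.{w} C] ⦃X Y : C⦄ ⦃n : ℤ⦄
    (f : (singleFunctor C 0).obj X ⟶ ((singleFunctor C 0).obj Y)⟦n⟧) (hn : n < 0) : f = 0 := by
  have : (((singleFunctor C 0).obj Y)⟦n⟧).IsGE (-n) :=
    TStructure.t.isGE_shift ((singleFunctor C 0).obj Y) 0 n (-n)
  exact TStructure.t.zero f 0 (-n)

lemma exists_singleFunctor_iso_of_distTriang [HasDerivedCategory.{w} C] {X Z : C}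
    {Y : DerivedCategory C} {f : (singleFunctor C 0).obj X ⟶ Y} {g : Y ⟶ (singleFunctor C 0).obj Z}
    {h : (singleFunctor C 0).obj Z ⟶ ((singleFunctor C 0).obj X)⟦(1 : ℤ)⟧}
    (hT : Triangle.mk f g h ∈ distTriang (DerivedCategory C)) :
    ∃ Y' : C, Nonempty (Y ≅ (singleFunctor C 0).obj Y') := by
  have hex (n : ℤ) := HomologySequence.exact₂ _ hT n
  have : Y.IsLE 0 := by
    rw [isLE_iff]
    intro i hi
    exact (hex i).isZero_X₂ ((isZero_of_isLE ((singleFunctor C 0).obj X) 0 i hi).eq_of_src _ _)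
      ((isZero_of_isLE ((singleFunctor C 0).obj Z) 0 i hi).eq_of_tgt _ _)
  have : Y.IsGE 0 := by
    rw [isGE_iff]
    intro i hi
    exact (hex i).isZero_X₂ ((isZero_of_isGE ((singleFunctor C 0).obj X) 0 i hi).eq_of_src _ _)
      ((isZero_of_isGE ((singleFunctor C 0).obj Z) 0 i hi).eq_of_tgt _ _)
  exact exists_iso_singleFunctor_obj_of_isGE_of_isLE Y 0

lemma exists_shortExact_of_distTriang [HasDerivedCategory.{w} C] {X Z : C}
    (h : (singleFunctor C 0).obj Z ⟶ ((singleFunctor C 0).obj X)⟦(1 : ℤ)⟧) :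
    ∃ (Y : C) (f : X ⟶ Y) (g : Y ⟶ Z) (w : f ≫ g = 0)
      (hS : (ShortComplex.mk f g w).ShortExact), hS.singleδ = h := by
  obtain ⟨Y', f', g', hT⟩ := distinguished_cocone_triangle₂ h
  obtain ⟨Y, ⟨e⟩⟩ := exists_singleFunctor_iso_of_distTriang hT
  obtain ⟨f, hf⟩ := (singleFunctor C 0).map_surjective (f' ≫ e.hom)
  obtain ⟨g, hg⟩ := (singleFunctor C 0).map_surjective (e.inv ≫ g')
  replace hT : Triangle.mk ((singleFunctor C 0).map f) ((singleFunctor C 0).map g) h ∈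
      distTriang (DerivedCategory C) :=
    isomorphic_distinguished _ hT _
      (Triangle.isoMk _ _ (Iso.refl ((singleFunctor C 0).obj X)) e.symm
        (Iso.refl ((singleFunctor C 0).obj Z))
        (show (singleFunctor C 0).map f ≫ e.inv = 𝟙 ((singleFunctor C 0).obj X) ≫ f' by simp [hf])
        (show (singleFunctor C 0).map g ≫ 𝟙 ((singleFunctor C 0).obj Z) = e.inv ≫ g' by simp [hg])
        (show h ≫ (𝟙 ((singleFunctor C 0).obj X))⟦(1 : ℤ)⟧' = 𝟙 ((singleFunctor C 0).obj Z) ≫ h by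
          simp))
  have hK := AbelianSubcategory.isLimitKernelForkOfDistTriang singleFunctor_hom_shift_eq_zero
    f g h hT
  have hC := AbelianSubcategory.isColimitCokernelCoforkOfDistTriang
    singleFunctor_hom_shift_eq_zero f g h hT
  have w : f ≫ g = 0 := (singleFunctor C 0).map_injective (by
    simpa using! comp_distTriang_mor_zero₁₂ _ hT)
  have hS : (ShortComplex.mk f g w).ShortExact :=
    { exact := ShortComplex.exact_of_f_is_kernel _ hK
      mono_f := mono_of_isLimit_fork hK
      epi_g := epi_of_isColimit_cofork hC }
  refine ⟨Y, f, g, w, hS, ?_⟩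
  obtain ⟨c, hc₁, hc₂⟩ := complete_distinguished_triangle_morphism _ _
    hS.singleTriangle_distinguished hT
    (𝟙 ((singleFunctor C 0).obj X)) (𝟙 ((singleFunctor C 0).obj Y))
    (show (singleFunctor C 0).map f ≫ 𝟙 ((singleFunctor C 0).obj Y) =
      𝟙 ((singleFunctor C 0).obj X) ≫ (singleFunctor C 0).map f by simp)
  obtain ⟨c, rfl⟩ := (singleFunctor C 0).map_surjective c
  change (singleFunctor C 0).map g ≫ (singleFunctor C 0).map c =
    𝟙 ((singleFunctor C 0).obj Y) ≫ (singleFunctor C 0).map g at hc₁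
  change hS.singleδ ≫ (𝟙 ((singleFunctor C 0).obj X))⟦(1 : ℤ)⟧' =
    (singleFunctor C 0).map c ≫ h at hc₂
  have : Epi g := hS.epi_g
  obtain rfl : c = 𝟙 _ := by
    rw [← cancel_epi g]
    apply (singleFunctor C 0).map_injective
    simpa using hc₁
  simpa using hc₂

lemma exists_extClass_eq [HasExt.{w} C] {X Z : C} (x : Ext Z X 1) :
    ∃ (Y : C) (f : X ⟶ Y) (g : Y ⟶ Z) (w : f ≫ g = 0)
      (hS : (ShortComplex.mk f g w).ShortExact), hS.extClass = x := by
  let := HasDerivedCategory.standard C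
  obtain ⟨Y, f, g, w, hS, h⟩ := exists_shortExact_of_distTriang x.hom
  exact ⟨Y, f, g, w, hS, Ext.ext (by rw [hS.extClass_hom, h])⟩

/-- A morphism between the outer left terms of two short exact sequences which identifies the
pushforward of the first class to the second one extends to a morphism of short exact sequences
that is the identity on the right. -/
lemma exists_hom_of_extClass_comp_eq [HasExt.{w} C] {X X' Y Y' Z : C}
    {f : X ⟶ Y} {g : Y ⟶ Z} {w : f ≫ g = 0} (hS : (ShortComplex.mk f g w).ShortExact)
    {f' : X' ⟶ Y'} {g' : Y' ⟶ Z} {w' : f' ≫ g' = 0} (hS' : (ShortComplex.mk f' g' w').ShortExact)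
    (a : X ⟶ X') (h : hS.extClass.comp (Ext.mk₀ a) (add_zero 1) = hS'.extClass) :
    ∃ b : Y ⟶ Y', f ≫ b = a ≫ f' ∧ b ≫ g' = g := by
  obtain ⟨b, hb⟩ := Ext.contravariant_sequence_exact₁ hS Y' (Ext.mk₀ (a ≫ f')) (add_zero 1) (by
    rw [← Ext.mk₀_comp_mk₀, ← Ext.comp_assoc_of_third_deg_zero, h]
    exact hS'.extClass_comp)
  obtain ⟨b, rfl⟩ := (Ext.mk₀_bijective _ _).2 b
  rw [Ext.mk₀_comp_mk₀] at hb
  replace hb : f ≫ b = a ≫ f' := (Ext.mk₀_bijective _ _).1 hb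
  have := hS.epi_g
  obtain ⟨c, hc⟩ : ∃ c : Z ⟶ Z, g ≫ c = b ≫ g' :=
    ⟨hS.exact.desc (b ≫ g') (by simp [reassoc_of% hb, w']), hS.exact.g_desc _ _⟩
  have hnat := ShortExact.extClass_naturality hS hS'
    { τ₁ := a, τ₂ := b, τ₃ := c, comm₁₂ := hb.symm, comm₂₃ := hc.symm }
  dsimp at hnat
  obtain ⟨d, hd⟩ := Ext.covariant_sequence_exact₃ _ hS' (Ext.mk₀ (𝟙 Z - c)) (zero_add 1) (by
    rw [sub_eq_add_neg, Ext.mk₀_add, Ext.mk₀_neg, Ext.add_comp, Ext.neg_comp, ← hnat,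
      Ext.mk₀_id_comp, h]
    exact add_neg_cancel _)
  obtain ⟨d, rfl⟩ := (Ext.mk₀_bijective _ _).2 d
  rw [Ext.mk₀_comp_mk₀] at hd
  replace hd : d ≫ g' = 𝟙 Z - c := (Ext.mk₀_bijective _ _).1 hd
  refine ⟨b + g ≫ d, ?_, ?_⟩
  · simp [hb, reassoc_of% w]
  · simp [hd, hc]

/-- The Yoneda product of two short exact sequences vanishes if and only if they can be
assembled into a filtered object. -/
lemma extClass_comp_extClass_eq_zero_iff [HasExt.{w} C] {P T M K Q : C}
    {i : P ⟶ T} {p : T ⟶ M} {w₁ : i ≫ p = 0} (h₁ : (ShortComplex.mk i p w₁).ShortExact)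
    {j : M ⟶ K} {q : K ⟶ Q} {w₂ : j ≫ q = 0} (h₂ : (ShortComplex.mk j q w₂).ShortExact)
    {n : ℕ} (hn : 1 + 1 = n) :
    h₂.extClass.comp h₁.extClass hn = 0 ↔
      ∃ (X : C) (f : T ⟶ X) (b : X ⟶ K) (w : f ≫ b ≫ q = 0),
        f ≫ b = p ≫ j ∧ (ShortComplex.mk f (b ≫ q) w).ShortExact := by
  constructor
  · intro h
    obtain ⟨x, hx⟩ := Ext.covariant_sequence_exact₃ _ h₁ _ hn h
    obtain ⟨X, f, g, w, hS, rfl⟩ := exists_extClass_eq x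
    obtain ⟨b, hb, rfl⟩ := exists_hom_of_extClass_comp_eq hS h₂ p hx
    exact ⟨X, f, b, w, hb, hS⟩
  · rintro ⟨X, f, b, w, hb, hS⟩
    have hnat := ShortExact.extClass_naturality hS h₂
      { τ₁ := p, τ₂ := b, τ₃ := 𝟙 Q, comm₁₂ := hb.symm, comm₂₃ := (by simp) }
    dsimp at hnat
    rw [Ext.mk₀_id_comp] at hnat
    rw [← hnat, Ext.comp_assoc_of_second_deg_zero]
    have := h₁.comp_extClass
    dsimp at this
    rw [this, Ext.comp_zero]

end

section

variable {A : Type u} [CommRing A]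

lemma ModuleCat.shortExact_mk_iff {X Y Z : ModuleCat.{v} A} {f : X ⟶ Y} {g : Y ⟶ Z}
    {w : f ≫ g = 0} : (ShortComplex.mk f g w).ShortExact ↔
      (∀ x, f x = 0 → x = 0) ∧ (∀ y, g y = 0 → ∃ x, f x = y) ∧ ∀ z, ∃ y, g y = z := by
  constructor
  · intro h
    exact ⟨(injective_iff_map_eq_zero f.hom).1 h.moduleCat_injective_f,
      (ShortComplex.moduleCat_exact_iff _).1 h.exact, h.moduleCat_surjective_g⟩
  · rintro ⟨h₁, h₂, h₃⟩
    exact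
      { exact := (ShortComplex.moduleCat_exact_iff _).2 h₂
        mono_f := (ModuleCat.mono_iff_injective f).2 ((injective_iff_map_eq_zero f.hom).2 h₁)
        epi_g := (ModuleCat.epi_iff_surjective g).2 h₃ }

lemma ModuleCat.comp_eq_comp_iff {X Y Y' Z : ModuleCat.{v} A} {f : X ⟶ Y} {g : Y ⟶ Z}
    {f' : X ⟶ Y'} {g' : Y' ⟶ Z} : f ≫ g = f' ≫ g' ↔ ∀ x, g (f x) = g' (f' x) :=
  ⟨fun h x ↦ ConcreteCategory.congr_hom h x, fun h ↦ ConcreteCategory.hom_ext _ _ h⟩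

lemma ModuleCat.comp_eq_zero_iff {X Y Z : ModuleCat.{v} A} {f : X ⟶ Y} {g : Y ⟶ Z} :
    f ≫ g = 0 ↔ ∀ x, g (f x) = 0 :=
  ⟨fun h x ↦ ConcreteCategory.congr_hom h x, fun h ↦ ConcreteCategory.hom_ext _ _ h⟩

/-- The amalgamated sum of two extensions of `R` and `S` by `P`, as an extension of `R × S`
by `P`. -/
lemma exists_amalgam_shortExact {P E R H S : ModuleCat.{v} A}
    {pe : P ⟶ E} {er : E ⟶ R} {wE : pe ≫ er = 0} (hE : (ShortComplex.mk pe er wE).ShortExact)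
    {ph : P ⟶ H} {hs : H ⟶ S} {wH : ph ≫ hs = 0} (hH : (ShortComplex.mk ph hs wH).ShortExact) :
    ∃ (T : ModuleCat.{v} A) (iE : E ⟶ T) (iH : H ⟶ T) (p : T ⟶ ModuleCat.of A (R × S))
      (w : (pe ≫ iE) ≫ p = 0),
      pe ≫ iE = ph ≫ iH ∧
      iE ≫ p = er ≫ ModuleCat.ofHom (.inl A R S) ∧
      iH ≫ p = hs ≫ ModuleCat.ofHom (.inr A R S) ∧
      (∀ t, ∃ e h, t = iE e + iH h) ∧
      (∀ {X : ModuleCat.{v} A} (a : E ⟶ X) (b : H ⟶ X), pe ≫ a = ph ≫ b →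
        ∃ c : T ⟶ X, iE ≫ c = a ∧ iH ≫ c = b) ∧
      (ShortComplex.mk (pe ≫ iE) p w).ShortExact := by
  rw [ModuleCat.shortExact_mk_iff] at hE hH
  rw [ModuleCat.comp_eq_zero_iff] at wE wH
  obtain ⟨iE₁, iE₂, iE₃⟩ := hE
  obtain ⟨iH₁, iH₂, iH₃⟩ := hH
  let N : Submodule A (E × H) := LinearMap.range (pe.hom.prod (-ph.hom))
  let p : ((E × H) ⧸ N) →ₗ[A] R × S := N.liftQ (er.hom.prodMap hs.hom) (by
    rintro _ ⟨x, rfl⟩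
    simp [wE, wH])
  have hcomm (x : P) : N.mkQ (pe x, 0) = N.mkQ (0, ph x) := by
    rw [← sub_eq_zero, ← map_sub]
    exact (Submodule.Quotient.mk_eq_zero N).2 ⟨x, by simp⟩
  refine ⟨ModuleCat.of A ((E × H) ⧸ N), ModuleCat.ofHom (N.mkQ ∘ₗ .inl A E H),
    ModuleCat.ofHom (N.mkQ ∘ₗ .inr A E H), ModuleCat.ofHom p, ?_, ?_, ?_, ?_, ?_, ?_, ?_⟩
  · ext x <;> simp [p, wE]
  · ext x; exact hcomm x
  · ext x <;> simp [p]
  · ext x <;> simp [p]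
  · intro t
    obtain ⟨⟨e, h⟩, rfl⟩ := N.mkQ_surjective t
    exact ⟨e, h, by simp [← map_add, -Submodule.mkQ_apply]⟩
  · intro X a b hab
    rw [ModuleCat.comp_eq_comp_iff] at hab
    refine ⟨ModuleCat.ofHom (N.liftQ (a.hom.coprod b.hom) ?_), ?_, ?_⟩
    · rintro _ ⟨x, rfl⟩
      simp [hab]
    · ext x; simp
    · ext x; simp
  · rw [ModuleCat.shortExact_mk_iff]
    refine ⟨fun x hx ↦ ?_, fun t ht ↦ ?_, fun ⟨r, s⟩ ↦ ?_⟩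
    · obtain ⟨y, hy⟩ := (Submodule.Quotient.mk_eq_zero N).1 hx
      obtain ⟨hy₁, hy₂⟩ := Prod.ext_iff.1 hy
      obtain rfl : y = 0 := iH₁ y (by simpa using hy₂)
      exact iE₁ x (hy₁.symm.trans (map_zero pe.hom))
    · obtain ⟨⟨e, h⟩, rfl⟩ := N.mkQ_surjective t
      obtain ⟨hx, hy⟩ := Prod.ext_iff.1 (show p (N.mkQ (e, h)) = 0 from ht)
      obtain ⟨x, rfl⟩ := iE₂ e (by simpa [p] using hx)
      obtain ⟨y, rfl⟩ := iH₂ h (by simpa [p] using hy)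
      refine ⟨x + y, ?_⟩
      change N.mkQ (pe (x + y), 0) = N.mkQ (pe x, ph y)
      rw [show (pe x, ph y) = (pe x, 0) + (0, ph y) by simp, map_add _ (pe x, 0), ← hcomm,
        ← map_add]
      simp
    · obtain ⟨e, rfl⟩ := iE₃ r
      obtain ⟨h, rfl⟩ := iH₃ s
      exact ⟨N.mkQ (e, h), by simp [p]⟩

/-- The fibre product of two extensions of `Q` by `R` and `S`, as an extension of `Q`
by `R × S`. -/
lemma exists_fibreProduct_shortExact {R F Q S G : ModuleCat.{v} A}
    {rf : R ⟶ F} {fq : F ⟶ Q} {wF : rf ≫ fq = 0} (hF : (ShortComplex.mk rf fq wF).ShortExact)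
    {sg : S ⟶ G} {gq : G ⟶ Q} {wG : sg ≫ gq = 0} (hG : (ShortComplex.mk sg gq wG).ShortExact) :
    ∃ (K : ModuleCat.{v} A) (pF : K ⟶ F) (pG : K ⟶ G) (j : ModuleCat.of A (R × S) ⟶ K)
      (w : j ≫ pF ≫ fq = 0),
      pF ≫ fq = pG ≫ gq ∧
      j ≫ pF = ModuleCat.ofHom (.fst A R S) ≫ rf ∧
      j ≫ pG = ModuleCat.ofHom (.snd A R S) ≫ sg ∧
      (∀ k k', pF k = pF k' → pG k = pG k' → k = k') ∧
      (∀ {X : ModuleCat.{v} A} (a : X ⟶ F) (b : X ⟶ G), a ≫ fq = b ≫ gq →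
        ∃ c : X ⟶ K, c ≫ pF = a ∧ c ≫ pG = b) ∧
      (ShortComplex.mk j (pF ≫ fq) w).ShortExact := by
  rw [ModuleCat.shortExact_mk_iff] at hF hG
  rw [ModuleCat.comp_eq_zero_iff] at wF wG
  obtain ⟨iF₁, iF₂, iF₃⟩ := hF
  obtain ⟨iG₁, iG₂, iG₃⟩ := hG
  let N : Submodule A (F × G) :=
    LinearMap.eqLocus (fq.hom ∘ₗ .fst A F G) (gq.hom ∘ₗ .snd A F G)
  let j : R × S →ₗ[A] N := (rf.hom.prodMap sg.hom).codRestrict N (fun x ↦ by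
    simp [N, wF, wG])
  refine ⟨ModuleCat.of A N, ModuleCat.ofHom (.fst A F G ∘ₗ N.subtype),
    ModuleCat.ofHom (.snd A F G ∘ₗ N.subtype), ModuleCat.ofHom j, ?_, ?_, ?_, ?_, ?_, ?_, ?_⟩
  · rw [ModuleCat.comp_eq_zero_iff]
    intro x
    exact wF x.1
  · rw [ModuleCat.comp_eq_comp_iff]
    intro x
    exact x.2
  · rfl
  · rfl
  · intro k k' h₁ h₂
    exact Subtype.ext (Prod.ext h₁ h₂)
  · intro X a b hab
    rw [ModuleCat.comp_eq_comp_iff] at hab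
    exact ⟨ModuleCat.ofHom ((a.hom.prod b.hom).codRestrict N hab), rfl, rfl⟩
  · rw [ModuleCat.shortExact_mk_iff]
    refine ⟨fun x hx ↦ ?_, fun ⟨⟨y, z⟩, hyz⟩ hy ↦ ?_, fun q ↦ ?_⟩
    · obtain ⟨h₁, h₂⟩ := Prod.ext_iff.1 (Subtype.ext_iff.1 hx)
      exact Prod.ext (iF₁ _ h₁) (iG₁ _ h₂)
    · obtain ⟨r, rfl⟩ := iF₂ y hy
      obtain ⟨s, rfl⟩ := iG₂ z (hyz.symm.trans hy)
      exact ⟨(r, s), rfl⟩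
    · obtain ⟨y, rfl⟩ := iF₃ q
      obtain ⟨z, hz⟩ := iG₃ (fq y)
      exact ⟨⟨(y, z), hz.symm⟩, rfl⟩

end

/-- A 3×3 'frame' of short exact sequences of `A`-modules — rows
`0 → P → E → R → 0`, `0 → S → G → Q → 0` and columns `0 → P → H → S → 0`,
`0 → R → F → Q → 0` — can be completed to a full commutative 3×3 diagram with
exact rows and columns (middle row `0 → H → X → F → 0`, middle column
`0 → E → X → G → 0`) if and only if the Baer sum of the Yoneda products
`[E] ∪ [F]` and `[H] ∪ [G]` vanishes in `Ext²(Q, P)`. -/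
theorem statement11 {A : Type u} [CommRing A] [HasExt.{w} (ModuleCat.{v} A)]
    {P E R H S F G Q : ModuleCat.{v} A}
    (pe : P ⟶ E) (er : E ⟶ R) (wE : pe ≫ er = 0)
    (hE : (ShortComplex.mk pe er wE).ShortExact)
    (ph : P ⟶ H) (hs : H ⟶ S) (wH : ph ≫ hs = 0)
    (hH : (ShortComplex.mk ph hs wH).ShortExact)
    (rf : R ⟶ F) (fq : F ⟶ Q) (wF : rf ≫ fq = 0)
    (hF : (ShortComplex.mk rf fq wF).ShortExact)
    (sg : S ⟶ G) (gq : G ⟶ Q) (wG : sg ≫ gq = 0)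
    (hG : (ShortComplex.mk sg gq wG).ShortExact) :
    (∃ (X : ModuleCat.{v} A) (ex : E ⟶ X) (hx : H ⟶ X) (xf : X ⟶ F) (xg : X ⟶ G),
      pe ≫ ex = ph ≫ hx ∧
      ex ≫ xf = er ≫ rf ∧
      hx ≫ xg = hs ≫ sg ∧
      xf ≫ fq = xg ≫ gq ∧
      ∃ (w1 : hx ≫ xf = 0) (w2 : ex ≫ xg = 0),
        (ShortComplex.mk hx xf w1).ShortExact ∧
        (ShortComplex.mk ex xg w2).ShortExact) ↔
    (hF.extClass.comp hE.extClass (by norm_num) +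
      hG.extClass.comp hH.extClass (by norm_num) : Ext Q P 2) = 0 := by
  obtain ⟨T, iE, iH, p, wT, sqT, iEp, iHp, surjT, descT, hT⟩ := exists_amalgam_shortExact hE hH
  obtain ⟨K, pF, pG, j, wK, sqK, jpF, jpG, extK, liftK, hK⟩ := exists_fibreProduct_shortExact hF hG
  have hE' : (Ext.mk₀ (ModuleCat.ofHom (.inl A R S))).comp hT.extClass (zero_add 1) =
      hE.extClass := by
    simpa using! (ShortComplex.ShortExact.extClass_naturality hE hT
      { τ₁ := 𝟙 P, τ₂ := iE, τ₃ := ModuleCat.ofHom (.inl A R S), comm₂₃ := iEp }).symm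
  have hH' : (Ext.mk₀ (ModuleCat.ofHom (.inr A R S))).comp hT.extClass (zero_add 1) =
      hH.extClass := by
    simpa using! (ShortComplex.ShortExact.extClass_naturality hH hT
      { τ₁ := 𝟙 P, τ₂ := iH, τ₃ := ModuleCat.ofHom (.inr A R S), comm₁₂ := by simp [sqT],
        comm₂₃ := iHp }).symm
  have hF' : hK.extClass.comp (Ext.mk₀ (ModuleCat.ofHom (.fst A R S))) (add_zero 1) =
      hF.extClass := by
    simpa using! ShortComplex.ShortExact.extClass_naturality hK hF
      { τ₁ := ModuleCat.ofHom (.fst A R S), τ₂ := pF, τ₃ := 𝟙 Q, comm₁₂ := jpF.symm }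
  have hG' : hK.extClass.comp (Ext.mk₀ (ModuleCat.ofHom (.snd A R S))) (add_zero 1) =
      hG.extClass := by
    simpa using! ShortComplex.ShortExact.extClass_naturality hK hG
      { τ₁ := ModuleCat.ofHom (.snd A R S), τ₂ := pG, τ₃ := 𝟙 Q, comm₁₂ := jpG.symm,
        comm₂₃ := by simp [sqK] }
  have hid : ModuleCat.ofHom (.fst A R S) ≫ ModuleCat.ofHom (.inl A R S) +
      ModuleCat.ofHom (.snd A R S) ≫ ModuleCat.ofHom (.inr A R S) =
        𝟙 (ModuleCat.of A (R × S)) := by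
    ext x <;> simp
  have key : (hF.extClass.comp hE.extClass (by norm_num) +
      hG.extClass.comp hH.extClass (by norm_num) : Ext Q P 2) =
        hK.extClass.comp hT.extClass (by norm_num) := by
    rw [← hE', ← hH', ← hF', ← hG', Ext.comp_assoc_of_second_deg_zero,
      Ext.comp_assoc_of_second_deg_zero, Ext.mk₀_comp_mk₀_assoc, Ext.mk₀_comp_mk₀_assoc,
      ← Ext.comp_add, ← Ext.add_comp, ← Ext.mk₀_add, hid, Ext.mk₀_id_comp]
  rw [key, extClass_comp_extClass_eq_zero_iff hT hK]
  rw [ModuleCat.shortExact_mk_iff] at hE hH hF hG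
  rw [ModuleCat.comp_eq_zero_iff] at wE wH wF wG
  rw [ModuleCat.comp_eq_comp_iff] at iEp iHp jpF jpG
  obtain ⟨iE₁, iE₂, iE₃⟩ := hE
  obtain ⟨iH₁, iH₂, iH₃⟩ := hH
  obtain ⟨iF₁, iF₂, iF₃⟩ := hF
  obtain ⟨iG₁, iG₂, iG₃⟩ := hG
  constructor
  · rintro ⟨X, ex, hx, xf, xg, sqP, sqR, sqS, sqQ, w₁, w₂, hrow, hcol⟩
    obtain ⟨f, rfl, rfl⟩ := descT ex hx sqP
    obtain ⟨b, rfl, rfl⟩ := liftK xf xg sqQ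
    rw [ModuleCat.shortExact_mk_iff] at hrow hcol
    rw [ModuleCat.comp_eq_zero_iff] at w₁ w₂
    rw [ModuleCat.comp_eq_comp_iff] at sqP sqR sqS sqT sqQ
    simp only [ModuleCat.comp_apply] at w₁ w₂ hrow hcol sqP sqR sqS
    have hfb : f ≫ b = p ≫ j := by
      rw [ModuleCat.comp_eq_comp_iff]
      intro t
      obtain ⟨e, h, rfl⟩ := surjT t
      apply extK <;> simp [w₁, w₂, sqR, sqS, jpF, jpG, iEp, iHp]
    refine ⟨X, f, b, by rw [reassoc_of% hfb, wK, Limits.comp_zero], hfb, ?_⟩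
    rw [ModuleCat.shortExact_mk_iff]
    simp only [ModuleCat.comp_apply]
    refine ⟨fun t ht ↦ ?_, fun x hx ↦ ?_, fun q ↦ ?_⟩
    · obtain ⟨e, h, rfl⟩ := surjT t
      rw [map_add] at ht
      have hh : hs h = 0 := iG₁ _ (by
        have := congrArg (fun x ↦ pG (b x)) ht
        simpa only [map_add, map_zero, w₂, zero_add, sqS] using this)
      obtain ⟨a, rfl⟩ := iH₂ h hh
      rw [← sqT, ← map_add] at ht ⊢
      rw [← map_add] at ht
      rw [hcol.1 _ ht, map_zero]
    · obtain ⟨r, hr⟩ := iF₂ _ hx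
      obtain ⟨e, rfl⟩ := iE₃ r
      obtain ⟨h, hh⟩ := hrow.2.1 (x - f (iE e)) (by rw [map_sub, map_sub, sqR, hr, sub_self])
      exact ⟨iE e + iH h, by rw [map_add, hh, add_sub_cancel]⟩
    · obtain ⟨y, rfl⟩ := iF₃ q
      obtain ⟨x, rfl⟩ := hrow.2.2 y
      exact ⟨x, rfl⟩
  · rintro ⟨X, f, b, w, hfb, hX⟩
    rw [ModuleCat.shortExact_mk_iff] at hX
    simp only [ModuleCat.comp_apply] at hX
    obtain ⟨hX₁, hX₂, hX₃⟩ := hX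
    rw [ModuleCat.comp_eq_comp_iff] at hfb
    have sqT' := ModuleCat.comp_eq_comp_iff.1 sqT
    have sqK' := ModuleCat.comp_eq_comp_iff.1 sqK
    have hEF (e : E) : pF (b (f (iE e))) = rf (er e) := by rw [hfb, jpF, iEp]; rfl
    have hEG (e : E) : pG (b (f (iE e))) = 0 := by rw [hfb, jpG, iEp]; exact map_zero sg.hom
    have hHF (h : H) : pF (b (f (iH h))) = 0 := by rw [hfb, jpF, iHp]; exact map_zero rf.hom
    have hHG (h : H) : pG (b (f (iH h))) = sg (hs h) := by rw [hfb, jpG, iHp]; rfl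
    refine ⟨X, iE ≫ f, iH ≫ f, b ≫ pF, b ≫ pG, by rw [reassoc_of% sqT], ?_, ?_, by simp [sqK],
      ?_, ?_, ?_, ?_⟩
    · exact ModuleCat.comp_eq_comp_iff.2 hEF
    · exact ModuleCat.comp_eq_comp_iff.2 hHG
    · exact ModuleCat.comp_eq_zero_iff.2 hHF
    · exact ModuleCat.comp_eq_zero_iff.2 hEG
    · rw [ModuleCat.shortExact_mk_iff]
      simp only [ModuleCat.comp_apply]
      refine ⟨fun h hh ↦ ?_, fun x hx ↦ ?_, fun y ↦ ?_⟩
      · obtain ⟨a, rfl⟩ := iH₂ h (iG₁ _ (by rw [← hHG, hh, map_zero, map_zero]))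
        rw [← sqT'] at hh
        have := (ModuleCat.shortExact_mk_iff.1 hT).1 a (hX₁ _ hh)
        rw [this, map_zero]
      · obtain ⟨t, rfl⟩ := hX₂ x (by rw [hx, map_zero])
        obtain ⟨e, h, rfl⟩ := surjT t
        simp only [map_add, hEF, hHF, add_zero] at hx
        obtain ⟨a, rfl⟩ := iE₂ e (iF₁ _ hx)
        exact ⟨ph a + h, by rw [sqT', map_add, map_add]⟩
      · obtain ⟨x, hx⟩ := hX₃ (fq y)
        obtain ⟨r, hr⟩ := iF₂ (y - pF (b x)) (by rw [map_sub, hx, sub_self])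
        obtain ⟨e, rfl⟩ := iE₃ r
        exact ⟨x + f (iE e), by rw [map_add, map_add, hEF, hr, add_sub_cancel]⟩
    · rw [ModuleCat.shortExact_mk_iff]
      simp only [ModuleCat.comp_apply]
      refine ⟨fun e he ↦ ?_, fun x hx ↦ ?_, fun y ↦ ?_⟩
      · obtain ⟨a, rfl⟩ := iE₂ e (iF₁ _ (by rw [← hEF, he, map_zero, map_zero]))
        have := (ModuleCat.shortExact_mk_iff.1 hT).1 a (hX₁ _ he)
        rw [this, map_zero]
      · obtain ⟨t, rfl⟩ := hX₂ x (by rw [sqK', hx, map_zero])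
        obtain ⟨e, h, rfl⟩ := surjT t
        simp only [map_add, hEG, hHG, zero_add] at hx
        obtain ⟨a, rfl⟩ := iH₂ h (iG₁ _ hx)
        exact ⟨e + pe a, by rw [← sqT', map_add, map_add]⟩
      · obtain ⟨x, hx⟩ := hX₃ (gq y)
        obtain ⟨s, hs'⟩ := iG₂ (y - pG (b x)) (by rw [map_sub, ← sqK', hx, sub_self])
        obtain ⟨h, rfl⟩ := iH₃ s
        exact ⟨x + f (iH h), by rw [map_add, map_add, hHG, hs', add_sub_cancel]⟩
end

section
/- Assume the 3×3 frame of extensions as above admits at least one completion X. Then the set of classes [X] ∈ Ext¹(Y, P) completing the diagram is a coset of Im β = Ker γ, where β : Ext¹(Q, P) → Ext¹(Y, P) and γ : Ext¹(Y, P) → Ext¹(R ⊕ S, P) come from applying Hom(−, P) to 0 → R ⊕ S → Y → Q → 0; equivalently, the set of solutions is a principal homogeneous space (torsor) under the abelian group Ext¹(Q, P) / Im(δ_F + δ_G). -/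
open CategoryTheory Abelian Limits

universe w v u

namespace CategoryTheory.ShortComplex.ShortExact

variable {C : Type u} [Category.{v} C] [Abelian C] [HasExt.{w} C]

lemma mk₀_f_comp_eq_zero_iff {S : ShortComplex C} (hS : S.ShortExact) {P : C} {n : ℕ}
    (y : Ext S.X₂ P n) :
    (Ext.mk₀ S.f).comp y (zero_add n) = 0 ↔
      ∃ b : Ext S.X₃ P n, y = (Ext.mk₀ S.g).comp b (zero_add n) := by
  constructor
  · intro h
    obtain ⟨b, hb⟩ := Ext.contravariant_sequence_exact₂ hS P y h
    exact ⟨b, hb.symm⟩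
  · rintro ⟨b, rfl⟩
    simp

lemma mk₀_g_comp_eq_zero_iff {S : ShortComplex C} (hS : S.ShortExact) {P : C}
    (b : Ext S.X₃ P 1) :
    (Ext.mk₀ S.g).comp b (zero_add 1) = 0 ↔
      ∃ φ : S.X₁ ⟶ P, b = hS.extClass.comp (Ext.mk₀ φ) (add_zero 1) := by
  constructor
  · intro h
    obtain ⟨x, hx⟩ := Ext.contravariant_sequence_exact₃ hS P b h (add_zero 1)
    obtain ⟨φ, rfl⟩ := (Ext.mk₀_bijective S.X₁ P).2 x
    exact ⟨φ, hx.symm⟩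
  · rintro ⟨φ, rfl⟩
    exact hS.comp_extClass_assoc _ _

/-- If two morphisms out of a short exact sequence starting with a biproduct are the identity on
the right-hand term and the two projections on the left-hand term, then the connecting
homomorphism is the sum of the connecting homomorphisms of the targets. -/
lemma extClass_comp_mk₀_desc {R S F G Y Q P : C}
    {rf : R ⟶ F} {fq : F ⟶ Q} {wF : rf ≫ fq = 0} (hF : (ShortComplex.mk rf fq wF).ShortExact)
    {sg : S ⟶ G} {gq : G ⟶ Q} {wG : sg ≫ gq = 0} (hG : (ShortComplex.mk sg gq wG).ShortExact)
    {i : R ⊞ S ⟶ Y} {p : Y ⟶ Q} {w : i ≫ p = 0} (hY : (ShortComplex.mk i p w).ShortExact)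
    (yF : Y ⟶ F) (yG : Y ⟶ G) (hyF : yF ≫ fq = p) (hyG : yG ≫ gq = p)
    (hiF : i ≫ yF = biprod.desc rf 0) (hiG : i ≫ yG = biprod.desc 0 sg)
    (f : R ⟶ P) (g : S ⟶ P) :
    hY.extClass.comp (Ext.mk₀ (biprod.desc f g)) (add_zero 1) =
      hF.extClass.comp (Ext.mk₀ f) (add_zero 1) + hG.extClass.comp (Ext.mk₀ g) (add_zero 1) := by
  have eF : hY.extClass.comp (Ext.mk₀ biprod.fst) (add_zero 1) = hF.extClass := by
    have := extClass_naturality hY hF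
      { τ₁ := biprod.fst
        τ₂ := yF
        τ₃ := 𝟙 Q
        comm₁₂ := by dsimp; rw [hiF]; ext <;> simp
        comm₂₃ := by simpa using hyF }
    simpa using this
  have eG : hY.extClass.comp (Ext.mk₀ biprod.snd) (add_zero 1) = hG.extClass := by
    have := extClass_naturality hY hG
      { τ₁ := biprod.snd
        τ₂ := yG
        τ₃ := 𝟙 Q
        comm₁₂ := by dsimp; rw [hiG]; ext <;> simp
        comm₂₃ := by simpa using hyG }
    simpa using this
  rw [biprod.desc_eq, Ext.mk₀_add, Ext.comp_add, ← Ext.mk₀_comp_mk₀, ← Ext.mk₀_comp_mk₀,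
    ← Ext.comp_assoc_of_third_deg_zero, ← Ext.comp_assoc_of_third_deg_zero, eF, eG]

end CategoryTheory.ShortComplex.ShortExact

/-- Torsor structure on the set of completions: completions of the 3×3 frame
correspond to classes `x ∈ Ext¹(Y, P)` with `γ(x) = [W]`, where
`γ : Ext¹(Y, P) → Ext¹(R ⊕ S, P)` and `β : Ext¹(Q, P) → Ext¹(Y, P)` are the
maps (given by composition with `R ⊕ S → Y` resp. `Y → Q`) in the long exact
sequence for `Hom(−, P)` applied to `0 → R ⊕ S → Y → Q → 0`.  Given one
solution `x₀`, the solution set is the coset `x₀ + Im β` with `Im β = Ker γ`,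
and it is a principal homogeneous space under
`Ext¹(Q, P) / Im(δ_F + δ_G)`. -/
theorem statement13 {A : Type u} [CommRing A] [HasExt.{w} (ModuleCat.{v} A)]
    {P E R H S F G Q : ModuleCat.{v} A}
    (pe : P ⟶ E) (er : E ⟶ R) (wE : pe ≫ er = 0)
    (hE : (ShortComplex.mk pe er wE).ShortExact)
    (ph : P ⟶ H) (hs : H ⟶ S) (wH : ph ≫ hs = 0)
    (hH : (ShortComplex.mk ph hs wH).ShortExact)
    (rf : R ⟶ F) (fq : F ⟶ Q) (wF : rf ≫ fq = 0)
    (hF : (ShortComplex.mk rf fq wF).ShortExact)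
    (sg : S ⟶ G) (gq : G ⟶ Q) (wG : sg ≫ gq = 0)
    (hG : (ShortComplex.mk sg gq wG).ShortExact)
    -- `Y = F ×_Q G`, with the short exact sequence `0 → R ⊕ S → Y → Q → 0`
    {Y : ModuleCat.{v} A} (yF : Y ⟶ F) (yG : Y ⟶ G)
    (hYpb : IsPullback yF yG fq gq)
    (ιY : R ⊞ S ⟶ Y)
    (hιYF : ιY ≫ yF = biprod.desc rf 0) (hιYG : ιY ≫ yG = biprod.desc 0 sg)
    (wY : ιY ≫ (yF ≫ fq) = 0)
    (hY : (ShortComplex.mk ιY (yF ≫ fq) wY).ShortExact)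
    -- `W` is the codiagonal pushout of `E ⊕ H`, with `0 → P → W → R ⊕ S → 0`
    {W : ModuleCat.{v} A} (pW : P ⟶ W) (wEH : E ⊞ H ⟶ W)
    (hWpo : IsPushout (biprod.desc (𝟙 P) (𝟙 P)) (biprod.map pe ph) pW wEH)
    (πW : W ⟶ R ⊞ S) (hπW : wEH ≫ πW = biprod.map er hs)
    (wW : pW ≫ πW = 0)
    (hW : (ShortComplex.mk pW πW wW).ShortExact)
    -- assume there is at least one completion, i.e. one class `x₀` with
    -- `γ(x₀) = [W]`
    (x₀ : Ext Y P 1)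
    (hx₀ : (Ext.mk₀ ιY).comp x₀ (zero_add 1) = hW.extClass) :
    -- `Im β = Ker γ`
    (∀ y : Ext Y P 1,
      (Ext.mk₀ ιY).comp y (zero_add 1) = 0 ↔
        ∃ b : Ext Q P 1, y = (Ext.mk₀ (yF ≫ fq)).comp b (zero_add 1)) ∧
    -- the solution set is the coset `x₀ + Im β`
    (∀ x : Ext Y P 1,
      (Ext.mk₀ ιY).comp x (zero_add 1) = hW.extClass ↔
        ∃ b : Ext Q P 1, x = x₀ + (Ext.mk₀ (yF ≫ fq)).comp b (zero_add 1)) ∧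
    -- torsor under `Ext¹(Q, P) / Im(δ_F + δ_G)` : two elements of
    -- `Ext¹(Q, P)` move `x₀` to the same solution iff they differ by an
    -- element of `Im(δ_F + δ_G)`
    (∀ b b' : Ext Q P 1,
      x₀ + (Ext.mk₀ (yF ≫ fq)).comp b (zero_add 1) =
        x₀ + (Ext.mk₀ (yF ≫ fq)).comp b' (zero_add 1) ↔
      ∃ (f : R ⟶ P) (g : S ⟶ P),
        b - b' = hF.extClass.comp (Ext.mk₀ f) (add_zero 1) +
          hG.extClass.comp (Ext.mk₀ g) (add_zero 1)) := by
  have key : ∀ y : Ext Y P 1, (Ext.mk₀ ιY).comp y (zero_add 1) = 0 ↔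
      ∃ b : Ext Q P 1, y = (Ext.mk₀ (yF ≫ fq)).comp b (zero_add 1) :=
    fun y => hY.mk₀_f_comp_eq_zero_iff y
  refine ⟨key, fun x => ?_, fun b b' => ?_⟩
  · have h := key (x - x₀)
    rw [sub_eq_add_neg, Ext.comp_add, Ext.comp_neg, hx₀, ← sub_eq_add_neg, ← sub_eq_add_neg,
      sub_eq_zero] at h
    simpa only [sub_eq_iff_eq_add'] using h
  · have h := hY.mk₀_g_comp_eq_zero_iff (b - b')
    dsimp only at h
    rw [sub_eq_add_neg, Ext.comp_add, Ext.comp_neg, ← sub_eq_add_neg, ← sub_eq_add_neg,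
      sub_eq_zero] at h
    have hδ := hF.extClass_comp_mk₀_desc (P := P) hG hY yF yG rfl hYpb.w.symm hιYF hιYG
    rw [add_right_inj, h]
    constructor
    · rintro ⟨φ, hφ⟩
      have hdesc : biprod.desc (biprod.inl ≫ φ) (biprod.inr ≫ φ) = φ :=
        biprod.hom_ext' _ _ (biprod.inl_desc _ _) (biprod.inr_desc _ _)
      refine ⟨biprod.inl ≫ φ, biprod.inr ≫ φ, ?_⟩
      rw [hφ, ← hδ, hdesc]
    · rintro ⟨f, g, hfg⟩
      exact ⟨biprod.desc f g, hfg.trans (hδ f g).symm⟩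
end

section
/- Grothendieck's criterion: given a 2-extension 0 → P → W → Y → Q → 0 of R-modules (i.e., exact with the image of W → Y equal to the kernel of Y → Q, call it M = R ⊕ S), its class in Ext²(Q, P) is zero if and only if there exists a module X fitting into a commutative diagram with exact rows 0 → P → W → M → 0 and 0 → P → X → Y → 0 and exact columns 0 → W → X → Q → 0 and the identity on P, such that W → X over P and X → Y lifting M → Y are compatible. -/
open CategoryTheory Abelian

universe w v u

section AbelianCategory

open Limits

variable {C : Type u} [Category.{v} C] [Abelian C]

/-- A quasi-isomorphism from a complex concentrated in degrees `≤ 0` to an object placed in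
degree `0` is an epimorphism in degree `0`. -/
lemma epi_f_zero_of_quasiIso_single {K : CochainComplex C ℤ} [K.IsStrictlyLE 0] {Y : C}
    (s : K ⟶ (CochainComplex.singleFunctor C 0).obj Y) [QuasiIso s] : Epi (s.f 0) := by
  let L := (CochainComplex.singleFunctor C 0).obj Y
  have := L.isIso_iCycles 0 1 (by simp) rfl
  have := L.isIso_homologyπ (-1) 0 (by simp) rfl
  have h₁ : Epi (HomologicalComplex.cyclesMap s 0 ≫ L.homologyπ 0) := by
    rw [← HomologicalComplex.homologyπ_naturality]
    infer_instance
  have h₂ : Epi (HomologicalComplex.cyclesMap s 0) := by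
    have : HomologicalComplex.cyclesMap s 0 =
        (HomologicalComplex.cyclesMap s 0 ≫ L.homologyπ 0) ≫ inv (L.homologyπ 0) := by simp
    rw [this]
    infer_instance
  have h₃ : Epi (K.iCycles 0 ≫ s.f 0) := by
    rw [← HomologicalComplex.cyclesMap_i]
    infer_instance
  exact epi_of_epi (K.iCycles 0) _

/-- Positive degree extension classes are killed by pulling back along some epimorphism. -/
lemma exists_epi_mk₀_comp_eq_zero [HasExt.{w} C] {Y P : C} (x : Ext.{w} Y P 1) :
    ∃ (Y' : C) (p : Y' ⟶ Y) (_ : Epi p), (Ext.mk₀ p).comp x (zero_add 1) = 0 := by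
  let := HasDerivedCategory.standard C
  let e := ((DerivedCategory.singleFunctors C).shiftIso 1 (-1) 0 (by simp)).app P
  let f : DerivedCategory.Q.obj ((CochainComplex.singleFunctor C 0).obj Y) ⟶
      DerivedCategory.Q.obj ((CochainComplex.singleFunctor C (-1)).obj P) :=
    x.hom ≫ e.hom
  obtain ⟨K, hK, s, hs, g, hf⟩ := DerivedCategory.right_fac_of_isStrictlyLE f 0
  have hs' : QuasiIso s := (DerivedCategory.isIso_Q_map_iff_quasiIso C s).1 hs
  have := epi_f_zero_of_quasiIso_single s
  let p : K.X 0 ⟶ Y := s.f 0 ≫ (HomologicalComplex.singleObjXSelf (.up ℤ) 0 Y).hom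
  let j : (CochainComplex.singleFunctor C 0).obj (K.X 0) ⟶ K :=
    HomologicalComplex.mkHomFromSingle (𝟙 _) (fun k hk ↦
      (K.isZero_of_isStrictlyLE 0 k (by simp at hk; lia)).eq_of_tgt _ _)
  have hj : j ≫ s = (CochainComplex.singleFunctor C 0).map p := by
    apply HomologicalComplex.from_single_hom_ext
    simp [j, p, CochainComplex.singleFunctor, CochainComplex.singleFunctors,
      HomologicalComplex.single_map_f_self]
    exact congrArg (· ≫ s.f 0)
      ((HomologicalComplex.mkHomFromSingle_f _ _).trans (Category.comp_id _))
  have hg : j ≫ g = 0 := by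
    apply HomologicalComplex.from_single_hom_ext
    exact (HomologicalComplex.isZero_single_obj_X (.up ℤ) (-1) P 0 (by simp)).eq_of_tgt _ _
  refine ⟨K.X 0, p, epi_comp' this (IsIso.epi_of_iso
    (HomologicalComplex.singleObjXSelf (.up ℤ) 0 Y).hom), ?_⟩
  ext
  have key : DerivedCategory.Q.map ((CochainComplex.singleFunctor C 0).map p) ≫ f = 0 := by
    rw [hf, ← hj, Functor.map_comp, Category.assoc, IsIso.hom_inv_id_assoc, ← Functor.map_comp,
      hg, Functor.map_zero]
  rw [Ext.comp_hom, Ext.mk₀_hom, ShiftedHom.mk₀_comp, Ext.zero_hom, ← cancel_mono e.hom,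
    Category.assoc, zero_comp]
  exact key

/-- Every class in `Ext¹` is the class of a short exact sequence. -/
lemma exists_shortExact_extClass_eq [HasExt.{w} C] {Y P : C} (x : Ext.{w} Y P 1) :
    ∃ (X : C) (f : P ⟶ X) (g : X ⟶ Y) (h : f ≫ g = 0)
      (hS : (ShortComplex.mk f g h).ShortExact), hS.extClass = x := by
  obtain ⟨Y', p, _, hx⟩ := exists_epi_mk₀_comp_eq_zero x
  let T := ShortComplex.mk _ _ (kernel.condition p)
  have hT : T.ShortExact := { exact := ShortComplex.exact_kernel p }
  obtain ⟨y, hy⟩ := Ext.contravariant_sequence_exact₃ hT P x hx (add_zero 1)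
  obtain ⟨φ, rfl⟩ := (Ext.mk₀_bijective _ _).2 y
  let q : pushout (kernel.ι p) φ ⟶ Y := pushout.desc p 0 (by simp)
  have hq : pushout.inl (kernel.ι p) φ ≫ q = p := pushout.inl_desc _ _ _
  have hq' : pushout.inr (kernel.ι p) φ ≫ q = 0 := pushout.inr_desc _ _ _
  have : Epi q := by
    have : Epi (pushout.inl (kernel.ι p) φ ≫ q) := by rwa [hq]
    exact epi_of_epi (pushout.inl (kernel.ι p) φ) q
  let S := ShortComplex.mk (pushout.inr (kernel.ι p) φ) q hq'
  have hS : S.ShortExact := by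
    have : Mono S.f := by dsimp [S]; infer_instance
    have : Epi S.g := by assumption
    refine { exact := S.exact_of_g_is_cokernel (CokernelCofork.IsColimit.ofπ' _ _ ?_) }
    intro Z k hk
    have hk' : kernel.ι p ≫ pushout.inl (kernel.ι p) φ ≫ k = 0 := by
      rw [pushout.condition_assoc]
      exact (φ ≫= hk).trans comp_zero
    have : Epi T.g := by assumption
    refine ⟨hT.exact.desc (pushout.inl (kernel.ι p) φ ≫ k) hk', ?_⟩
    apply pushout.hom_ext
    · rw [← Category.assoc]
      exact (hq =≫ _).trans (hT.exact.g_desc _ _)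
    · rw [← Category.assoc]
      exact (hq' =≫ _).trans (zero_comp.trans hk.symm)
  refine ⟨_, _, q, hq', hS, ?_⟩
  have := hT.extClass_naturality hS
    { τ₁ := φ, τ₂ := pushout.inl (kernel.ι p) φ, τ₃ := 𝟙 Y
      comm₁₂ := pushout.condition.symm
      comm₂₃ := by simp [S, T, hq] }
  rw [← hy, this]
  exact (Ext.mk₀_id_comp _).symm

/-- If the class of `S` is the pullback of the class of `T` along `m : S.X₃ ⟶ T.X₃`, with the
same left-hand term, then `m` lifts to a morphism of extensions that is the identity on that
term. -/
lemma exists_lift_of_mk₀_comp_extClass_eq [HasExt.{w} C] {P W M X Y : C}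
    {i : P ⟶ W} {r : W ⟶ M} {hir : i ≫ r = 0} (hS : (ShortComplex.mk i r hir).ShortExact)
    {f : P ⟶ X} {g : X ⟶ Y} {hfg : f ≫ g = 0} (hT : (ShortComplex.mk f g hfg).ShortExact)
    (m : M ⟶ Y)
    (h : (Ext.mk₀ m).comp hT.extClass (zero_add 1) = (hS.extClass : Ext.{w} M P 1)) :
    ∃ l : W ⟶ X, i ≫ l = f ∧ l ≫ g = r ≫ m := by
  have h₀ : (Ext.mk₀ (r ≫ m)).comp hT.extClass (zero_add 1) = 0 := by
    rw [← Ext.mk₀_comp_mk₀_assoc, h]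
    exact hS.comp_extClass
  obtain ⟨l, hl⟩ := Ext.covariant_sequence_exact₃ W hT _ (zero_add 1) h₀
  obtain ⟨l, rfl⟩ := (Ext.mk₀_bijective _ _).2 l
  replace hl : l ≫ g = r ≫ m := by
    apply (Ext.mk₀_bijective _ _).1
    rw [← hl, Ext.mk₀_comp_mk₀]
  have := hT.mono_f
  let t : P ⟶ P := hT.exact.lift (i ≫ l) (by simp [hl, reassoc_of% hir])
  have ht : t ≫ f = i ≫ l := hT.exact.lift_f _ _
  have ht' : hS.extClass.comp (Ext.mk₀ t) (add_zero 1) = hS.extClass := by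
    rw [hS.extClass_naturality hT { τ₁ := t, τ₂ := l, τ₃ := m, comm₁₂ := ht, comm₂₃ := hl }, h]
  have h₁ : hS.extClass.comp (Ext.mk₀ (t - 𝟙 P)) (add_zero 1) = 0 := by
    have h₂ := hS.extClass.comp_add (Ext.mk₀ (t - 𝟙 P)) (Ext.mk₀ (𝟙 P)) (add_zero 1)
    rw [← Ext.mk₀_add, sub_add_cancel, ht', Ext.comp_mk₀_id] at h₂
    exact left_eq_add.1 (h₂.trans (add_comm _ _))
  obtain ⟨v, hv⟩ := Ext.contravariant_sequence_exact₁ hS P _ _ h₁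
  obtain ⟨v, rfl⟩ := (Ext.mk₀_bijective _ _).2 v
  replace hv : i ≫ v = t - 𝟙 P := by
    apply (Ext.mk₀_bijective _ _).1
    rw [← hv, Ext.mk₀_comp_mk₀]
  refine ⟨l - v ≫ f, ?_, ?_⟩
  · rw [Preadditive.comp_sub, reassoc_of% hv, Preadditive.sub_comp, ht]
    simp
  · simp [hfg, hl]

end AbelianCategory

/-- Given a morphism of extensions of modules, from `0 → P → W → M → 0` to `0 → P → X → Y → 0`,
over `m : M ⟶ Y` and the identity of `P`, the map `l : W ⟶ X` is injective and its cokernel is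
that of `m`. -/
lemma shortExact_of_extension_hom {A : Type u} [CommRing A] {P W M X Y Q : ModuleCat.{v} A}
    {i : P ⟶ W} {r : W ⟶ M} {hir : i ≫ r = 0} (hW : (ShortComplex.mk i r hir).ShortExact)
    {m : M ⟶ Y} {q : Y ⟶ Q} {hmq : m ≫ q = 0} (hY : (ShortComplex.mk m q hmq).ShortExact)
    {f : P ⟶ X} {g : X ⟶ Y} {hfg : f ≫ g = 0} (hX : (ShortComplex.mk f g hfg).ShortExact)
    {l : W ⟶ X} (hl : i ≫ l = f) (hlg : l ≫ g = r ≫ m) (hlq : l ≫ g ≫ q = 0) :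
    (ShortComplex.mk l (g ≫ q) hlq).ShortExact := by
  have hl' (p : P) : l (i p) = f p := by rw [← hl]; rfl
  have hlg' (w : W) : g (l w) = m (r w) := ConcreteCategory.congr_hom hlg w
  have hf : Function.Injective f := hX.moduleCat_injective_f
  have hm : Function.Injective m := hY.moduleCat_injective_f
  have hr : Function.Surjective r := hW.moduleCat_surjective_g
  have hg : Function.Surjective g := hX.moduleCat_surjective_g
  have hq : Function.Surjective q := hY.moduleCat_surjective_g
  refine .mk' ?_ ?_ ?_
  · rw [ShortComplex.moduleCat_exact_iff]
    intro x hx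
    obtain ⟨n, hn⟩ := (ShortComplex.moduleCat_exact_iff _).1 hY.exact (g x) hx
    obtain ⟨w, rfl⟩ := hr n
    obtain ⟨p, hp⟩ := (ShortComplex.moduleCat_exact_iff _).1 hX.exact (x - l w)
      (((map_sub g.hom x (l w)).trans (sub_eq_zero.2 (hn.symm.trans (hlg' w).symm))))
    refine ⟨w + i p, ?_⟩
    change l (w + i p) = x
    change f p = x - l w at hp
    rw [map_add, hl', hp, add_sub_cancel]
  · refine (ModuleCat.mono_iff_injective _).2 ((injective_iff_map_eq_zero l.hom).2 fun w hw ↦ ?_)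
    change l w = 0 at hw
    have hrw : r w = 0 := hm (by rw [← hlg', hw, map_zero, map_zero])
    obtain ⟨p, rfl⟩ := (ShortComplex.moduleCat_exact_iff _).1 hW.exact w hrw
    have hp : p = 0 := hf (by rw [← hl', map_zero]; exact hw)
    rw [hp, map_zero]
  · exact (ModuleCat.epi_iff_surjective _).2 (hq.comp hg)

/-- Grothendieck's criterion: given a 2-extension `0 → P → W → Y → Q → 0` of
`A`-modules, presented as a splice of short exact sequences `0 → P → W → M → 0`
and `0 → M → Y → Q → 0` (where `M` is the image of `W → Y`, the kernel of
`Y → Q`), its class in `Ext²(Q, P)` — the image of `[W] ∈ Ext¹(M, P)` under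
the connecting homomorphism `δ : Ext¹(M, P) → Ext²(Q, P)` of
`0 → M → Y → Q → 0`, i.e. the composition with the extension class of that
sequence — vanishes if and only if there exists `X` fitting into a commutative
diagram with exact rows `0 → P → W → M → 0`, `0 → P → X → Y → 0` (identity on
`P`) and exact column `0 → W → X → Q → 0`, the map `X → Y` lifting `M → Y`. -/
theorem statement15 {A : Type u} [CommRing A] [HasExt.{w} (ModuleCat.{v} A)]
    {P W M Y Q : ModuleCat.{v} A}
    (i : P ⟶ W) (wm : W ⟶ M) (wW : i ≫ wm = 0)
    (hW : (ShortComplex.mk i wm wW).ShortExact)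
    (my : M ⟶ Y) (yq : Y ⟶ Q) (wY : my ≫ yq = 0)
    (hY : (ShortComplex.mk my yq wY).ShortExact) :
    (hY.extClass.comp hW.extClass (by norm_num) : Ext Q P 2) = 0 ↔
    ∃ (X : ModuleCat.{v} A) (px : P ⟶ X) (wx : W ⟶ X) (xy : X ⟶ Y),
      -- the rows are compatible via the identity on `P`
      i ≫ wx = px ∧
      -- `X → Y` lifts `M → Y` through `W → M`
      wx ≫ xy = wm ≫ my ∧
      -- `0 → P → X → Y → 0` is short exact
      (∃ w1 : px ≫ xy = 0, (ShortComplex.mk px xy w1).ShortExact) ∧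
      -- `0 → W → X → Q → 0` is short exact
      (∃ w2 : wx ≫ (xy ≫ yq) = 0,
        (ShortComplex.mk wx (xy ≫ yq) w2).ShortExact) := by
  constructor
  · intro h
    obtain ⟨x, hx⟩ := Ext.contravariant_sequence_exact₁ hY P _ _ h
    obtain ⟨X, px, xy, w1, hX, rfl⟩ := exists_shortExact_extClass_eq x
    obtain ⟨wx, h₁, h₂⟩ := exists_lift_of_mk₀_comp_extClass_eq hW hX my hx
    have w2 : wx ≫ xy ≫ yq = 0 := by rw [reassoc_of% h₂, wY, Limits.comp_zero]
    exact ⟨X, px, wx, xy, h₁, h₂, ⟨w1, hX⟩, w2,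
      shortExact_of_extension_hom hW hY hX h₁ h₂ w2⟩
  · rintro ⟨X, px, wx, xy, h₁, h₂, ⟨w1, hX⟩, -⟩
    have h := hW.extClass_naturality hX
      { τ₁ := 𝟙 P, τ₂ := wx, τ₃ := my
        comm₁₂ := (Category.id_comp _).trans h₁.symm
        comm₂₃ := h₂ }
    replace h : hW.extClass = (Ext.mk₀ my).comp hX.extClass (zero_add 1) := by
      rw [← h]; exact (Ext.comp_mk₀_id _).symm
    rw [h]
    exact hY.extClass_comp_assoc hX.extClass
end
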